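/- Let Ω ⊂ ℝⁿ be a bounded open domain with C¹ boundary and let φ ∈ C²(Ω) ∩ C¹(Ω̄), φ not identically zero, satisfy the Dirichlet eigenvalue problem −Δφ = λφ in Ω with φ = 0 on ∂Ω, for some λ ∈ ℝ. Then λ ≥ n |B₁|^{1/n} · inf_{∂Ω} |∇φ| / ‖φ‖_{L^n(Ω)}. -/

import Mathlib

open MeasureTheory Metric
open scoped RealInnerProductSpace

noncomputable section

/-- `ν` is an outward unit normal vector field on the boundary of `Ω`
(in the first-order sense appropriate for a `C¹` boundary). -/
def IsOutwardUnitNormal {n : ℕ} (Ω : Set (EuclideanSpace ℝ (Fin n)))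
    (ν : EuclideanSpace ℝ (Fin n) → EuclideanSpace ℝ (Fin n)) : Prop :=
  ContinuousOn ν (frontier Ω) ∧
  ∀ x ∈ frontier Ω, ‖ν x‖ = 1 ∧
    ∀ ε > 0, ∃ δ > 0, ∀ y ∈ closure Ω, dist y x < δ →
      ⟪ν x, y - x⟫ ≤ ε * ‖y - x‖

/-- The Laplacian `Δu(x) = Σᵢ ∂²u/∂xᵢ²` of `u : ℝⁿ → ℝ` at `x`. -/
def lap {n : ℕ} (u : EuclideanSpace ℝ (Fin n) → ℝ)
    (x : EuclideanSpace ℝ (Fin n)) : ℝ :=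
  ∑ i, iteratedFDeriv ℝ 2 u x ![EuclideanSpace.single i 1, EuclideanSpace.single i 1]

theorem stay_inside {n : ℕ} {Ω : Set (EuclideanSpace ℝ (Fin n))} (hΩo : IsOpen Ω)
    {ν : EuclideanSpace ℝ (Fin n) → EuclideanSpace ℝ (Fin n)}
    (hν : IsOutwardUnitNormal Ω ν) {x₀ : EuclideanSpace ℝ (Fin n)} (hx₀ : x₀ ∈ frontier Ω)
    {d : EuclideanSpace ℝ (Fin n)} (hd : ⟪ν x₀, d⟫ < 0) :
    ∃ r > 0, ∀ y ∈ Ω, dist y x₀ < r → ∀ t ∈ Set.Icc (0 : ℝ) r, y + t • d ∈ Ω := by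
  have hc : ContinuousWithinAt (fun z => ⟪ν z, d⟫) (frontier Ω) x₀ :=
    (hν.1 x₀ hx₀).inner continuousWithinAt_const
  have hev := hc.eventually (gt_mem_nhds hd)
  rw [Filter.Eventually, mem_nhdsWithin_iff] at hev
  obtain ⟨δ, hδ, hsub⟩ := hev
  have hd1 : 0 < 1 + ‖d‖ := by positivity
  refine ⟨δ / (2 * (1 + ‖d‖)), by positivity, ?_⟩
  set r := δ / (2 * (1 + ‖d‖)) with hr
  have hrδ : r * (1 + ‖d‖) = δ / 2 := by rw [hr]; field_simp
  have hr0 : 0 < r := by positivity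
  intro y hy hyx t ht
  by_contra hcon
  let S : Set ℝ := Set.Icc 0 r ∩ (fun t : ℝ => y + t • d) ⁻¹' Ωᶜ
  have hcont : Continuous (fun t : ℝ => y + t • d) := by fun_prop
  have hS : IsCompact S := isCompact_Icc.inter_right (hΩo.isClosed_compl.preimage hcont)
  obtain ⟨t₀, ht₀, hmin⟩ := hS.exists_isLeast ⟨t, ht, hcon⟩
  have hlt : ∀ s, 0 ≤ s → s < t₀ → y + s • d ∈ Ω := by
    intro s hs0 hs
    by_contra h
    exact absurd (hmin ⟨⟨hs0, hs.le.trans ht₀.1.2⟩, h⟩) (not_le.2 hs)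
  have ht0pos : 0 < t₀ := by
    rcases ht₀.1.1.lt_or_eq with h | h
    · exact h
    · exfalso; apply ht₀.2; simpa [← h] using hy
  set z := y + t₀ • d with hz
  have hzcl : z ∈ closure Ω := by
    have h1 : t₀ ∈ closure (Set.Ico 0 t₀) := by
      rw [closure_Ico ht0pos.ne]; exact ⟨ht0pos.le, le_rfl⟩
    exact map_mem_closure (f := fun t : ℝ => y + t • d) hcont h1 (fun s hs => hlt s hs.1 hs.2)
  have hzf : z ∈ frontier Ω := by
    rw [hΩo.frontier_eq]; exact ⟨hzcl, ht₀.2⟩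
  have hzd : dist z x₀ < δ := by
    have h1 : dist z y ≤ r * ‖d‖ := by
      rw [dist_eq_norm, hz, add_sub_cancel_left, norm_smul, Real.norm_of_nonneg ht0pos.le]
      exact mul_le_mul_of_nonneg_right ht₀.1.2 (norm_nonneg _)
    have := dist_triangle z y x₀
    nlinarith
  have hneg : ⟪ν z, d⟫ < 0 := hsub ⟨hzd, hzf⟩
  obtain ⟨δ', hδ', hin⟩ := (hν.2 z hzf).2 (-⟪ν z, d⟫ / (2 * (1 + ‖d‖)))
    (div_pos (by linarith) (by positivity))
  set τ := min t₀ (δ' / (2 * (1 + ‖d‖))) with hτ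
  have hτ0 : 0 < τ := lt_min ht0pos (by positivity)
  have hτ1 : τ * (1 + ‖d‖) ≤ δ' / 2 := by
    calc τ * (1 + ‖d‖) ≤ δ' / (2 * (1 + ‖d‖)) * (1 + ‖d‖) :=
          mul_le_mul_of_nonneg_right (min_le_right _ _) hd1.le
      _ = δ' / 2 := by field_simp
  have hw : y + (t₀ - τ) • d ∈ Ω :=
    hlt _ (sub_nonneg.2 (min_le_left _ _)) (by linarith)
  have hwz : y + (t₀ - τ) • d - z = -(τ • d) := by rw [hz, sub_smul]; abel
  have hnorm : ‖y + (t₀ - τ) • d - z‖ = τ * ‖d‖ := by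
    rw [hwz, norm_neg, norm_smul, Real.norm_of_nonneg hτ0.le]
  have := hin _ (subset_closure hw) (by rw [dist_eq_norm, hnorm]; linarith)
  rw [hnorm, hwz, inner_neg_right, real_inner_smul_right] at this
  have h3 : -⟪ν z, d⟫ / (2 * (1 + ‖d‖)) * (τ * ‖d‖) < -⟪ν z, d⟫ * τ := by
    rw [div_mul_eq_mul_div, div_lt_iff₀ (by positivity)]
    have : 0 < -⟪ν z, d⟫ * τ := mul_pos (by linarith) hτ0
    nlinarith [norm_nonneg d]
  linarith

theorem boundary_deriv {n : ℕ} {Ω : Set (EuclideanSpace ℝ (Fin n))} (hΩo : IsOpen Ω)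
    {ν : EuclideanSpace ℝ (Fin n) → EuclideanSpace ℝ (Fin n)}
    (hν : IsOutwardUnitNormal Ω ν)
    {φ : EuclideanSpace ℝ (Fin n) → ℝ}
    {G : EuclideanSpace ℝ (Fin n) → EuclideanSpace ℝ (Fin n)}
    (hG : ∀ x ∈ Ω, HasGradientAt φ (G x) x)
    (hGc : ContinuousOn G (closure Ω))
    {x₀ : EuclideanSpace ℝ (Fin n)} (hx₀ : x₀ ∈ frontier Ω)
    {d p : EuclideanSpace ℝ (Fin n)} (hd : ⟪ν x₀, d⟫ < 0)
    (hp : ∀ y ∈ closure Ω, |φ y| ≤ ⟪p, y - x₀⟫) :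
    |⟪G x₀, d⟫| ≤ ⟪p, d⟫ := by
  have hx₀c : x₀ ∈ closure Ω := frontier_subset_closure hx₀
  refine le_of_forall_pos_le_add fun η hη => ?_
  obtain ⟨r, hr, hin⟩ := stay_inside hΩo hν hx₀ hd
  have hc : ContinuousWithinAt (fun z => ⟪G z, d⟫) (closure Ω) x₀ :=
    (hGc x₀ hx₀c).inner continuousWithinAt_const
  obtain ⟨δ, hδ, hcl⟩ := Metric.continuousWithinAt_iff.1 hc η hη
  have hd1 : 0 < 1 + ‖d‖ := by positivity
  set t := min r (δ / (2 * (1 + ‖d‖))) with ht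
  have ht0 : 0 < t := lt_min hr (by positivity)
  have ht1 : t * (1 + ‖d‖) ≤ δ / 2 := by
    calc t * (1 + ‖d‖) ≤ δ / (2 * (1 + ‖d‖)) * (1 + ‖d‖) :=
          mul_le_mul_of_nonneg_right (min_le_right _ _) hd1.le
      _ = δ / 2 := by field_simp
  have : (nhdsWithin x₀ Ω).NeBot := mem_closure_iff_nhdsWithin_neBot.1 hx₀c
  have key : ∀ᶠ y in nhdsWithin x₀ Ω,
      t * |⟪G x₀, d⟫| ≤ ⟪p, y + t • d - x₀⟫ + ⟪p, y - x₀⟫ + t * η := by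
    have h1 : ∀ᶠ y in nhdsWithin x₀ Ω, dist y x₀ < min r (δ / 2) :=
      nhdsWithin_le_nhds (Metric.ball_mem_nhds x₀ (by positivity))
    filter_upwards [h1, self_mem_nhdsWithin] with y hy hyΩ
    have hseg : ∀ s ∈ Set.Icc 0 t, y + s • d ∈ Ω := fun s hs =>
      hin y hyΩ (hy.trans_le (min_le_left _ _)) s ⟨hs.1, hs.2.trans (min_le_left _ _)⟩
    have hder : ∀ s ∈ Set.Icc 0 t,
        HasDerivAt (fun s : ℝ => φ (y + s • d)) ⟪G (y + s • d), d⟫ s := by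
      intro s hs
      have h2 : HasDerivAt (fun s : ℝ => y + s • d) d s := by
        simpa using ((hasDerivAt_id s).smul_const d).const_add y
      have h3 := (hG _ (hseg s hs)).hasFDerivAt.comp_hasDerivAt s h2
      rw [InnerProductSpace.toDual_apply_apply] at h3
      exact h3
    obtain ⟨c, hc, hceq⟩ := exists_hasDerivAt_eq_slope (fun s : ℝ => φ (y + s • d))
      (fun s => ⟪G (y + s • d), d⟫) ht0
      (fun s hs => (hder s hs).continuousAt.continuousWithinAt)
      (fun s hs => hder s ⟨hs.1.le, hs.2.le⟩)
    have hcI : c ∈ Set.Icc 0 t := ⟨hc.1.le, hc.2.le⟩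
    have hdist : dist (y + c • d) x₀ < δ := by
      have h1 : dist (y + c • d) y ≤ t * ‖d‖ := by
        rw [dist_eq_norm, add_sub_cancel_left, norm_smul, Real.norm_of_nonneg hcI.1]
        exact mul_le_mul_of_nonneg_right hcI.2 (norm_nonneg _)
      have := dist_triangle (y + c • d) y x₀
      have := hy.trans_le (min_le_right _ _)
      nlinarith
    have h4 := hcl (subset_closure (hseg c hcI)) hdist
    rw [Real.dist_eq] at h4
    have h5 : t * ⟪G (y + c • d), d⟫ = φ (y + t • d) - φ y := by
      simp only [sub_zero, zero_smul, add_zero] at hceq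
      rw [hceq]; field_simp
    have h6 := hp _ (subset_closure (hseg t ⟨ht0.le, le_rfl⟩))
    have h7 := hp _ (subset_closure hyΩ)
    have h8 : |t * ⟪G (y + c • d), d⟫| ≤ |φ (y + t • d)| + |φ y| := by
      rw [h5]; exact abs_sub _ _
    rw [abs_mul, abs_of_pos ht0] at h8
    have h9 : |⟪G x₀, d⟫| ≤ |⟪G (y + c • d), d⟫| + η := by
      have := abs_sub_abs_le_abs_sub ⟪G x₀, d⟫ ⟪G (y + c • d), d⟫
      rw [abs_sub_comm] at this
      linarith
    nlinarith
  have hlim : Filter.Tendsto (fun y => ⟪p, y + t • d - x₀⟫ + ⟪p, y - x₀⟫ + t * η)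
      (nhdsWithin x₀ Ω) (nhds (⟪p, x₀ + t • d - x₀⟫ + ⟪p, x₀ - x₀⟫ + t * η)) := by
    apply Filter.Tendsto.mono_left _ nhdsWithin_le_nhds
    apply Continuous.tendsto
    fun_prop
  have := ge_of_tendsto hlim key
  rw [add_sub_cancel_left, sub_self, inner_zero_right, real_inner_smul_right] at this
  have h : t * |⟪G x₀, d⟫| ≤ t * (⟪p, d⟫ + η) := by linarith
  exact le_of_mul_le_mul_left h ht0

theorem boundary_norm {n : ℕ} {Ω : Set (EuclideanSpace ℝ (Fin n))} (hΩo : IsOpen Ω)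
    {ν : EuclideanSpace ℝ (Fin n) → EuclideanSpace ℝ (Fin n)}
    (hν : IsOutwardUnitNormal Ω ν)
    {φ : EuclideanSpace ℝ (Fin n) → ℝ}
    {G : EuclideanSpace ℝ (Fin n) → EuclideanSpace ℝ (Fin n)}
    (hG : ∀ x ∈ Ω, HasGradientAt φ (G x) x)
    (hGc : ContinuousOn G (closure Ω))
    {x₀ : EuclideanSpace ℝ (Fin n)} (hx₀ : x₀ ∈ frontier Ω)
    {p : EuclideanSpace ℝ (Fin n)}
    (hp : ∀ y ∈ closure Ω, |φ y| ≤ ⟪p, y - x₀⟫) :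
    ‖G x₀‖ ≤ ‖p‖ := by
  have h1 : ∀ d, ⟪ν x₀, d⟫ ≠ 0 → |⟪G x₀, d⟫| ≤ ‖p‖ * ‖d‖ := by
    intro d hd
    rcases lt_or_gt_of_ne hd with h | h
    · exact (boundary_deriv hΩo hν hG hGc hx₀ h hp).trans (real_inner_le_norm _ _)
    · have := boundary_deriv hΩo hν hG hGc hx₀ (d := -d) (by simpa using h) hp
      rw [inner_neg_right, abs_neg] at this
      exact this.trans ((real_inner_le_norm _ _).trans (by rw [norm_neg]))
  have h2 : |⟪G x₀, G x₀⟫| ≤ ‖p‖ * ‖G x₀‖ := by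
    by_cases h : ⟪ν x₀, G x₀⟫ = 0
    · have hlim : Filter.Tendsto (fun t : ℝ => ‖p‖ * ‖G x₀ + t • ν x₀‖ - |⟪G x₀, G x₀ + t • ν x₀⟫|)
          (nhdsWithin 0 (Set.Ioi 0))
          (nhds (‖p‖ * ‖G x₀ + (0:ℝ) • ν x₀‖ - |⟪G x₀, G x₀ + (0:ℝ) • ν x₀⟫|)) := by
        apply Filter.Tendsto.mono_left _ nhdsWithin_le_nhds
        apply Continuous.tendsto
        fun_prop
      have := ge_of_tendsto hlim (b := 0) (by
        filter_upwards [self_mem_nhdsWithin] with t ht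
        refine sub_nonneg.2 (h1 _ ?_)
        rw [inner_add_right, h, real_inner_smul_right, real_inner_self_eq_norm_sq,
          (hν.2 x₀ hx₀).1]
        simpa using (ne_of_gt ht))
      simpa using this
    · exact h1 _ h
  rw [real_inner_self_eq_norm_sq, abs_of_nonneg (by positivity), sq] at h2
  by_contra hcon
  push Not at hcon
  have : 0 < ‖G x₀‖ := (norm_nonneg p).trans_lt hcon
  nlinarith

/-- touching points -/
theorem exists_touch {n : ℕ} {Ω : Set (EuclideanSpace ℝ (Fin n))} (hΩo : IsOpen Ω)
    (hΩb : Bornology.IsBounded Ω)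
    {ν : EuclideanSpace ℝ (Fin n) → EuclideanSpace ℝ (Fin n)}
    (hν : IsOutwardUnitNormal Ω ν)
    {φ : EuclideanSpace ℝ (Fin n) → ℝ}
    {G : EuclideanSpace ℝ (Fin n) → EuclideanSpace ℝ (Fin n)}
    (hφ : ContinuousOn φ (closure Ω))
    (hG : ∀ x ∈ Ω, HasGradientAt φ (G x) x)
    (hGc : ContinuousOn G (closure Ω))
    (hφne : ∃ x ∈ Ω, φ x ≠ 0)
    (hbd : ∀ x ∈ frontier Ω, φ x = 0)
    (p : EuclideanSpace ℝ (Fin n)) (hp : p = 0 ∨ ∀ x ∈ frontier Ω, ‖p‖ < ‖G x‖) :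
    ∃ x ∈ Ω, φ x ≠ 0 ∧ IsLocalMax (fun y => |φ y| - ⟪p, y⟫) x := by
  have hK : IsCompact (closure Ω) := hΩb.isCompact_closure
  obtain ⟨a, ha, hane⟩ := hφne
  obtain ⟨x, hx, hmax⟩ := hK.exists_isMaxOn ⟨a, subset_closure ha⟩
    (f := fun y => |φ y| - ⟪p, y⟫) (by fun_prop)
  have hmax' : ∀ y ∈ closure Ω, |φ y| - |φ x| ≤ ⟪p, y - x⟫ := by
    intro y hy
    have := hmax hy
    simp only [Set.mem_ofPred_eq] at this
    rw [inner_sub_right]; linarith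
  have hp0 : φ x = 0 → p ≠ 0 := by
    rintro h rfl
    have := hmax' a (subset_closure ha)
    rw [h] at this
    simp at this
    exact hane this
  have hxΩ : x ∈ Ω := by
    by_contra hcon
    have hxf : x ∈ frontier Ω := by rw [hΩo.frontier_eq]; exact ⟨hx, hcon⟩
    have h0 := hbd x hxf
    have h1 := hp.resolve_left (hp0 h0) x hxf
    have h2 := boundary_norm hΩo hν hG hGc hxf (p := p) (fun y hy => by
      simpa [h0] using hmax' y hy)
    linarith
  refine ⟨x, hxΩ, fun h0 => ?_, ?_⟩
  · have hpne := hp0 h0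
    have hcont : Continuous (fun t : ℝ => x - t • p) := by fun_prop
    have : ∀ᶠ t in nhdsWithin (0:ℝ) (Set.Ioi 0), x - t • p ∈ Ω := by
      apply nhdsWithin_le_nhds
      exact hcont.continuousAt.preimage_mem_nhds (hΩo.mem_nhds (by simpa using hxΩ))
    obtain ⟨t, ht, ht0⟩ := (this.and self_mem_nhdsWithin).exists
    have h1 := hmax' _ (subset_closure ht)
    rw [h0, sub_sub_cancel_left, inner_neg_right, real_inner_smul_right,
      real_inner_self_eq_norm_sq] at h1
    have : 0 < t * ‖p‖ ^ 2 := mul_pos ht0 (by positivity)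
    have := abs_nonneg (φ (x - t • p))
    simp at h1
    linarith
  · exact (hmax.on_subset subset_closure).isLocalMax (hΩo.mem_nhds hxΩ)

theorem det_le_of_nonneg {n : ℕ} (hn : 0 < n)
    (L : EuclideanSpace ℝ (Fin n) →ₗ[ℝ] EuclideanSpace ℝ (Fin n)) (hL : L.IsSymmetric)
    (hpos : ∀ v, 0 ≤ ⟪L v, v⟫) :
    0 ≤ LinearMap.trace ℝ _ L ∧
    |LinearMap.det L| ≤ (LinearMap.trace ℝ _ L / n) ^ n := by
  have hfr : Module.finrank ℝ (EuclideanSpace ℝ (Fin n)) = n := by simp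
  have hev : ∀ i, 0 ≤ hL.eigenvalues hfr i := by
    intro i
    have h := hpos (hL.eigenvectorBasis hfr i)
    rw [hL.apply_eigenvectorBasis, real_inner_smul_left, real_inner_self_eq_norm_sq] at h
    simpa using h
  have htr := hL.trace_eq_sum_eigenvalues hfr
  have hdet := hL.det_eq_prod_eigenvalues hfr
  simp only [RCLike.ofReal_real_eq_id, id] at htr hdet
  rw [htr, hdet]
  refine ⟨Finset.sum_nonneg fun i _ => hev i, ?_⟩
  have hpr : 0 ≤ ∏ i, hL.eigenvalues hfr i := Finset.prod_nonneg fun i _ => hev i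
  have hn' : (0:ℝ) < n := by exact_mod_cast hn
  rw [abs_of_nonneg hpr]
  have := Real.geom_mean_le_arith_mean Finset.univ (fun _ => (1:ℝ)) (hL.eigenvalues hfr)
    (fun _ _ => zero_le_one) (by simpa using hn) (fun i _ => hev i)
  simp only [Real.rpow_one, Finset.sum_const, Finset.card_univ, Fintype.card_fin, nsmul_eq_mul,
    mul_one, one_mul] at this
  calc ∏ i, hL.eigenvalues hfr i = ((∏ i, hL.eigenvalues hfr i) ^ ((n:ℝ)⁻¹)) ^ n :=
        (Real.rpow_inv_natCast_pow hpr hn.ne').symm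
    _ ≤ _ := pow_le_pow_left₀ (by positivity) this n

theorem second_order {n : ℕ} {ψ : EuclideanSpace ℝ (Fin n) → ℝ}
    {g : EuclideanSpace ℝ (Fin n) → EuclideanSpace ℝ (Fin n)}
    {x p : EuclideanSpace ℝ (Fin n)}
    {M : EuclideanSpace ℝ (Fin n) →L[ℝ] EuclideanSpace ℝ (Fin n)}
    (hg : ∀ᶠ y in nhds x, HasGradientAt ψ (g y) y) (hM : HasFDerivAt g M x)
    (hmax : IsLocalMax (fun y => ψ y - ⟪p, y⟫) x) :
    g x = p ∧ ∀ v, ⟪M v, v⟫ ≤ 0 := by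
  have hline : ∀ (v : EuclideanSpace ℝ (Fin n)) (t : ℝ),
      HasDerivAt (fun s : ℝ => x + s • v) v t := fun v t => by
    simpa using ((hasDerivAt_id t).smul_const v).const_add x
  have hcont : ∀ v : EuclideanSpace ℝ (Fin n),
      Filter.Tendsto (fun s : ℝ => x + s • v) (nhds 0) (nhds x) := fun v => by
    have := (hline v 0).continuousAt.tendsto
    simpa using this
  have hder : ∀ v, ∀ᶠ t in nhds (0:ℝ),
      HasDerivAt (fun s : ℝ => ψ (x + s • v) - ⟪p, x + s • v⟫) (⟪g (x + t • v) - p, v⟫) t := by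
    intro v
    filter_upwards [(hcont v).eventually hg] with t ht
    have h3 := ht.hasFDerivAt.comp_hasDerivAt t (hline v t)
    rw [InnerProductSpace.toDual_apply_apply] at h3
    have h4 := (innerSL ℝ p).hasFDerivAt.comp_hasDerivAt t (hline v t)
    have h5 := h3.sub h4
    rw [innerSL_apply_apply, ← inner_sub_left] at h5
    exact h5
  have hlm : ∀ v, IsLocalMax (fun s : ℝ => ψ (x + s • v) - ⟪p, x + s • v⟫) 0 := by
    intro v
    have := (hcont v).eventually hmax
    filter_upwards [this] with t ht
    simpa using ht
  have h0 : ∀ v, ⟪g x - p, v⟫ = 0 := by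
    intro v
    have := (hlm v).hasDerivAt_eq_zero (hder v).self_of_nhds
    simpa using this
  have hgx : g x = p := by
    have := h0 (g x - p)
    rw [inner_self_eq_zero] at this
    exact sub_eq_zero.1 this
  refine ⟨hgx, fun v => ?_⟩
  by_contra hcon
  push Not at hcon
  set f := fun s : ℝ => ψ (x + s • v) - ⟪p, x + s • v⟫ with hf
  have hd1 : deriv f =ᶠ[nhds 0] fun t => ⟪g (x + t • v) - p, v⟫ := by
    filter_upwards [hder v] with t ht using ht.deriv
  have hd2 : HasDerivAt (fun t : ℝ => ⟪g (x + t • v) - p, v⟫) ⟪M v, v⟫ 0 := by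
    have hM' : HasFDerivAt g M (x + (0:ℝ) • v) := by simpa using hM
    have h3 := hM'.comp_hasDerivAt (0:ℝ) (hline v 0)
    have h4 := (innerSL ℝ v).hasFDerivAt.comp_hasDerivAt (0:ℝ) (h3.sub_const p)
    rw [innerSL_apply_apply, real_inner_comm] at h4
    refine h4.congr_of_eventuallyEq (Filter.Eventually.of_forall fun t => ?_)
    simp [real_inner_comm]
  have hdd : deriv (deriv f) 0 = ⟪M v, v⟫ := by rw [hd1.deriv_eq]; exact hd2.deriv
  have hmin : IsLocalMin f 0 := isLocalMin_of_deriv_deriv_pos (by rw [hdd]; exact hcon)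
    ((hlm v).deriv_eq_zero) (hder v).self_of_nhds.continuousAt
  have hconst : f =ᶠ[nhds 0] fun _ => f 0 := by
    filter_upwards [hmin, hlm v] with t h1 h2 using le_antisymm h2 h1
  have : deriv (deriv f) 0 = 0 := by
    have h1 : deriv f =ᶠ[nhds 0] fun _ => 0 := by
      filter_upwards [hconst.eventuallyEq_nhds] with t ht
      rw [ht.deriv_eq]; simp
    rw [h1.deriv_eq]; simp
  linarith

theorem hessian_facts {n : ℕ} {Ω : Set (EuclideanSpace ℝ (Fin n))} (hΩo : IsOpen Ω)
    {φ : EuclideanSpace ℝ (Fin n) → ℝ}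
    {G : EuclideanSpace ℝ (Fin n) → EuclideanSpace ℝ (Fin n)}
    (hφ2 : ContDiffOn ℝ 2 φ Ω)
    (hG : ∀ x ∈ Ω, HasGradientAt φ (G x) x) :
    ContinuousOn (fderiv ℝ G) Ω ∧ ∀ x ∈ Ω, HasFDerivAt G (fderiv ℝ G x) x ∧
      (fderiv ℝ G x : EuclideanSpace ℝ (Fin n) →ₗ[ℝ] EuclideanSpace ℝ (Fin n)).IsSymmetric ∧
      lap φ x = LinearMap.trace ℝ _
        (fderiv ℝ G x : EuclideanSpace ℝ (Fin n) →ₗ[ℝ] EuclideanSpace ℝ (Fin n)) := by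
  have hfd : ∀ y ∈ Ω, fderiv ℝ φ y = innerSL ℝ (G y) := by
    intro y hy
    rw [(hG y hy).hasFDerivAt.fderiv]
    ext v; simp
  have hGC : ContDiffOn ℝ 1 G Ω := by
    have h1 : ContDiffOn ℝ 1 (fderiv ℝ φ) Ω := hφ2.fderiv_of_isOpen hΩo (by norm_num)
    have h2 : ContDiffOn ℝ 1 (fun y => (InnerProductSpace.toDual ℝ
        (EuclideanSpace ℝ (Fin n))).symm (fderiv ℝ φ y)) Ω :=
      (InnerProductSpace.toDual ℝ
        (EuclideanSpace ℝ (Fin n))).symm.toContinuousLinearEquiv.contDiff.comp_contDiffOn h1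
    refine h2.congr fun y hy => ?_
    rw [(hG y hy).hasFDerivAt.fderiv]; simp
  refine ⟨hGC.continuousOn_fderiv_of_isOpen hΩo le_rfl, fun x hx => ?_⟩
  have hGd : HasFDerivAt G (fderiv ℝ G x) x :=
    ((hGC.contDiffAt (hΩo.mem_nhds hx)).differentiableAt (by norm_num)).hasFDerivAt
  have hff : ∀ v w, fderiv ℝ (fderiv ℝ φ) x v w = ⟪fderiv ℝ G x v, w⟫ := by
    intro v w
    have h1 : fderiv ℝ φ =ᶠ[nhds x] fun y => innerSL ℝ (G y) := by
      filter_upwards [hΩo.mem_nhds hx] with y hy using hfd y hy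
    have h2 : HasFDerivAt (fun y => innerSL ℝ (G y)) _ x :=
      (innerSL ℝ (E := EuclideanSpace ℝ (Fin n))).hasFDerivAt.comp x hGd
    rw [h1.fderiv_eq, h2.fderiv]
    rfl
  refine ⟨hGd, ?_, ?_⟩
  · intro v w
    have hs := (hφ2.contDiffAt (hΩo.mem_nhds hx)).isSymmSndFDerivAt (by simp)
    have := hs v w
    rw [hff, hff] at this
    simp only [ContinuousLinearMap.coe_coe]
    rw [this, real_inner_comm]
  · rw [LinearMap.trace_eq_sum_inner _ (EuclideanSpace.basisFun (Fin n) ℝ), lap]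
    refine Finset.sum_congr rfl fun i _ => ?_
    rw [iteratedFDeriv_two_apply]
    simp only [Matrix.cons_val_zero, Matrix.cons_val_one, EuclideanSpace.basisFun_apply]
    rw [hff, real_inner_comm]; rfl

/-- what happens at touching points -/
theorem touch_facts {n : ℕ} (hn : 0 < n) {Ω : Set (EuclideanSpace ℝ (Fin n))} (hΩo : IsOpen Ω)
    {φ : EuclideanSpace ℝ (Fin n) → ℝ}
    {G : EuclideanSpace ℝ (Fin n) → EuclideanSpace ℝ (Fin n)}
    (hφ2 : ContDiffOn ℝ 2 φ Ω)
    (hG : ∀ x ∈ Ω, HasGradientAt φ (G x) x)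
    {lam : ℝ} (heig : ∀ x ∈ Ω, -lap φ x = lam * φ x)
    {x p : EuclideanSpace ℝ (Fin n)} (hx : x ∈ Ω) (hne : φ x ≠ 0)
    (hmax : IsLocalMax (fun y => |φ y| - ⟪p, y⟫) x) :
    Real.sign (φ x) • G x = p ∧ 0 ≤ lam * |φ x| ∧
      |(fderiv ℝ G x).det| ≤ (lam * |φ x| / n) ^ n := by
  obtain ⟨-, hH⟩ := hessian_facts hΩo hφ2 hG
  obtain ⟨hGd, hsym, hlap⟩ := hH x hx
  have hcx : ContinuousAt φ x := (hG x hx).continuousAt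
  set s := Real.sign (φ x) with hs
  have hs1 : (s = 1 ∨ s = -1) ∧ s * φ x = |φ x| ∧ ∀ᶠ y in nhds x, |φ y| = s * φ y := by
    rcases lt_or_gt_of_ne hne with h | h
    · rw [hs, Real.sign_of_neg h]
      refine ⟨Or.inr rfl, by rw [abs_of_neg h]; ring, ?_⟩
      filter_upwards [hcx.eventually (gt_mem_nhds h)] with y hy
      rw [abs_of_neg hy]; ring
    · rw [hs, Real.sign_of_pos h]
      refine ⟨Or.inl rfl, by rw [abs_of_pos h]; ring, ?_⟩
      filter_upwards [hcx.eventually (lt_mem_nhds h)] with y hy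
      rw [abs_of_pos hy]; ring
  obtain ⟨hs1, habs, hev⟩ := hs1
  have hmax' : IsLocalMax (fun y => s * φ y - ⟪p, y⟫) x := by
    refine hmax.congr ?_
    filter_upwards [hev] with y hy
    rw [hy]
  have hgr : ∀ᶠ y in nhds x, HasGradientAt (fun y => s * φ y) (s • G y) y := by
    filter_upwards [hΩo.mem_nhds hx] with y hy
    rw [hasGradientAt_iff_hasFDerivAt, map_smul]
    exact (hG y hy).hasFDerivAt.const_mul s
  obtain ⟨h1, h2⟩ := second_order hgr (hGd.const_smul s) hmax'
  refine ⟨h1, ?_⟩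
  set L : EuclideanSpace ℝ (Fin n) →ₗ[ℝ] EuclideanSpace ℝ (Fin n) :=
    (fderiv ℝ G x : EuclideanSpace ℝ (Fin n) →ₗ[ℝ] EuclideanSpace ℝ (Fin n)) with hL
  have hsym' : ((-s) • L).IsSymmetric := by
    intro v w
    simp only [LinearMap.smul_apply, real_inner_smul_left, real_inner_smul_right]
    rw [hsym v w]
  obtain ⟨h3, h4⟩ := det_le_of_nonneg hn ((-s) • L) hsym' (fun v => by
    have := h2 v
    simp only [_root_.smul_apply, real_inner_smul_left] at this
    simp only [LinearMap.smul_apply, real_inner_smul_left, hL, ContinuousLinearMap.coe_coe]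
    linarith)
  have htr : LinearMap.trace ℝ _ ((-s) • L) = lam * |φ x| := by
    rw [map_smul, ← hlap, ← habs, smul_eq_mul]
    linear_combination s * heig x hx
  rw [htr] at h3 h4
  refine ⟨h3, ?_⟩
  rw [LinearMap.det_smul, abs_mul, abs_pow] at h4
  have : |-s| = 1 := by rcases hs1 with h | h <;> simp [h]
  rw [this, one_pow, one_mul] at h4
  exact h4

theorem stmt13 {n : ℕ} (hn : 0 < n)
    (Ω : Set (EuclideanSpace ℝ (Fin n))) (hΩo : IsOpen Ω)
    (hΩb : Bornology.IsBounded Ω) (hΩne : Ω.Nonempty)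
    (ν : EuclideanSpace ℝ (Fin n) → EuclideanSpace ℝ (Fin n))
    (hν : IsOutwardUnitNormal Ω ν)
    (φ : EuclideanSpace ℝ (Fin n) → ℝ)
    (G : EuclideanSpace ℝ (Fin n) → EuclideanSpace ℝ (Fin n))
    -- `φ ∈ C²(Ω) ∩ C¹(Ω̄)`
    (hφ2 : ContDiffOn ℝ 2 φ Ω)
    (hφ : ContinuousOn φ (closure Ω))
    (hG : ∀ x ∈ Ω, HasGradientAt φ (G x) x)
    (hGc : ContinuousOn G (closure Ω))
    -- `φ` not identically zero
    (hφne : ∃ x ∈ Ω, φ x ≠ 0)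
    -- `-Δφ = λ φ` in `Ω`
    (lam : ℝ) (heig : ∀ x ∈ Ω, -lap φ x = lam * φ x)
    -- `φ = 0` on `∂Ω`
    (hbd : ∀ x ∈ frontier Ω, φ x = 0) :
    lam ≥ n * (volume (Metric.ball (0 : EuclideanSpace ℝ (Fin n)) 1)).toReal ^ ((n : ℝ)⁻¹) *
      sInf ((fun x => ‖G x‖) '' frontier Ω) / (∫ x in Ω, |φ x| ^ (n : ℝ)) ^ ((n : ℝ)⁻¹) := by
  set m := sInf ((fun x => ‖G x‖) '' frontier Ω) with hm
  set I := ∫ x in Ω, |φ x| ^ (n : ℝ) with hI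
  set B := (volume (Metric.ball (0 : EuclideanSpace ℝ (Fin n)) 1)).toReal with hB
  have hn' : (0:ℝ) < n := by exact_mod_cast hn
  have hI0 : 0 ≤ I := integral_nonneg fun x => by positivity
  have hB0 : 0 ≤ B := ENNReal.toReal_nonneg
  have hm0 : 0 ≤ m := Real.sInf_nonneg (by rintro _ ⟨x, -, rfl⟩; exact norm_nonneg _)
  have hmle : ∀ x ∈ frontier Ω, m ≤ ‖G x‖ := fun x hx =>
    csInf_le ⟨0, by rintro _ ⟨x, -, rfl⟩; exact norm_nonneg _⟩ ⟨x, hx, rfl⟩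
  have hlam : 0 ≤ lam := by
    obtain ⟨x, hx, hne, hmax⟩ := exists_touch hΩo hΩb hν hφ hG hGc hφne hbd 0 (Or.inl rfl)
    obtain ⟨-, h, -⟩ := touch_facts hn hΩo hφ2 hG heig hx hne hmax
    exact nonneg_of_mul_nonneg_left h (abs_pos.2 hne)
  obtain ⟨hcf, hH⟩ := hessian_facts hΩo hφ2 hG
  have hφΩ : ContinuousOn φ Ω := hφ.mono subset_closure
  -- the good set
  set U : Set (EuclideanSpace ℝ (Fin n)) := Ω ∩ φ ⁻¹' {0}ᶜ with hU
  have hUo : IsOpen U := hφΩ.isOpen_inter_preimage hΩo isOpen_compl_singleton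
  set F : EuclideanSpace ℝ (Fin n) → ℝ :=
    fun x => |(fderiv ℝ G x).det| - (lam * |φ x| / n) ^ n with hF
  have hFc : ContinuousOn F U := by
    have h1 : ContinuousOn (fun x => (fderiv ℝ G x).det) U :=
      ContinuousLinearMap.continuous_det.comp_continuousOn (hcf.mono Set.inter_subset_left)
    have h2 : ContinuousOn φ U := hφΩ.mono Set.inter_subset_left
    fun_prop
  set A : Set (EuclideanSpace ℝ (Fin n)) := U \ (U ∩ F ⁻¹' Set.Ioi 0) with hA
  have hAm : MeasurableSet A :=
    hUo.measurableSet.diff (hFc.isOpen_inter_preimage hUo isOpen_Ioi).measurableSet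
  have hAΩ : A ⊆ Ω := fun x hx => hx.1.1
  have hAF : ∀ x ∈ A, |(fderiv ℝ G x).det| ≤ (lam * |φ x| / n) ^ n := by
    intro x hx
    by_contra hcon
    exact hx.2 ⟨hx.1, by simpa [hF] using hcon⟩
  set T : EuclideanSpace ℝ (Fin n) → EuclideanSpace ℝ (Fin n) :=
    fun x => Real.sign (φ x) • G x with hT
  have hsub : Metric.ball 0 m ⊆ T '' A := by
    intro p hp
    have hp' : ‖p‖ < m := by simpa using hp
    obtain ⟨x, hx, hne, hmax⟩ := exists_touch hΩo hΩb hν hφ hG hGc hφne hbd p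
      (Or.inr fun x hx => hp'.trans_le (hmle x hx))
    obtain ⟨h1, h2, h3⟩ := touch_facts hn hΩo hφ2 hG heig hx hne hmax
    refine ⟨x, ⟨⟨hx, hne⟩, fun h => ?_⟩, h1⟩
    have := h.2
    simp only [hF, Set.mem_preimage, Set.mem_Ioi] at this
    linarith
  have hTd : ∀ x ∈ A, HasFDerivWithinAt T (Real.sign (φ x) • fderiv ℝ G x) A x := by
    intro x hx
    have hcx : ContinuousAt φ x := (hG x hx.1.1).continuousAt
    have hev : T =ᶠ[nhds x] fun y => Real.sign (φ x) • G y := by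
      rcases lt_or_gt_of_ne (show φ x ≠ 0 from hx.1.2) with h | h
      · filter_upwards [hcx.eventually (gt_mem_nhds h)] with y hy
        simp only [hT]; rw [Real.sign_of_neg h, Real.sign_of_neg hy]
      · filter_upwards [hcx.eventually (lt_mem_nhds h)] with y hy
        simp only [hT]; rw [Real.sign_of_pos h, Real.sign_of_pos hy]
    exact (((hH x hx.1.1).1.const_smul _).congr_of_eventuallyEq hev).hasFDerivWithinAt
  have hdet : ∀ x ∈ A, |(Real.sign (φ x) • fderiv ℝ G x).det| ≤ (lam * |φ x| / n) ^ n := by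
    intro x hx
    refine le_trans (le_of_eq ?_) (hAF x hx)
    have h1 : |Real.sign (φ x)| = 1 := by
      rcases lt_or_gt_of_ne (show φ x ≠ 0 from hx.1.2) with h | h
      · simp [Real.sign_of_neg h]
      · simp [Real.sign_of_pos h]
    have h2 : (Real.sign (φ x) • fderiv ℝ G x).det =
        Real.sign (φ x) ^ n * (fderiv ℝ G x).det := by
      have := LinearMap.det_smul (Real.sign (φ x))
        (fderiv ℝ G x : EuclideanSpace ℝ (Fin n) →ₗ[ℝ] EuclideanSpace ℝ (Fin n))
      rw [finrank_euclideanSpace_fin] at this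
      exact this
    rw [h2, abs_mul, abs_pow, h1, one_pow, one_mul]
  have hint : IntegrableOn (fun x => (lam * |φ x| / n) ^ n) Ω := by
    refine IntegrableOn.mono_set ?_ (subset_closure (s := Ω))
    refine ContinuousOn.integrableOn_compact hΩb.isCompact_closure ?_
    fun_prop
  have hIeq : ∫ x in Ω, (lam * |φ x| / n) ^ n = (lam / n) ^ n * I := by
    rw [hI, ← integral_const_mul]
    refine integral_congr_ae (Filter.Eventually.of_forall fun x => ?_)
    simp only [Real.rpow_natCast]
    rw [← mul_pow]; congr 1; ring
  have hmain : volume (Metric.ball (0 : EuclideanSpace ℝ (Fin n)) m)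
      ≤ ENNReal.ofReal ((lam / n) ^ n * I) := by
    calc volume (Metric.ball (0 : EuclideanSpace ℝ (Fin n)) m) ≤ volume (T '' A) :=
          measure_mono hsub
      _ ≤ ∫⁻ x in A, ENNReal.ofReal |(Real.sign (φ x) • fderiv ℝ G x).det| :=
          addHaar_image_le_lintegral_abs_det_fderiv volume hAm hTd
      _ ≤ ∫⁻ x in A, ENNReal.ofReal ((lam * |φ x| / n) ^ n) :=
          setLIntegral_mono' hAm fun x hx => ENNReal.ofReal_le_ofReal (hdet x hx)
      _ ≤ ∫⁻ x in Ω, ENNReal.ofReal ((lam * |φ x| / n) ^ n) := lintegral_mono_set hAΩ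
      _ = ENNReal.ofReal (∫ x in Ω, (lam * |φ x| / n) ^ n) :=
          (ofReal_integral_eq_lintegral_ofReal hint
            (Filter.Eventually.of_forall fun x => by positivity)).symm
      _ = _ := by rw [hIeq]
  have hreal : m ^ n * B ≤ (lam / n) ^ n * I := by
    have : Nonempty (Fin n) := ⟨⟨0, hn⟩⟩
    rw [Measure.addHaar_ball _ _ hm0, finrank_euclideanSpace_fin] at hmain
    have h1 := ENNReal.toReal_le_of_le_ofReal (by positivity) hmain
    rwa [ENNReal.toReal_mul, ENNReal.toReal_ofReal (by positivity)] at h1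
  have hroot : m * B ^ ((n:ℝ)⁻¹) ≤ lam / n * I ^ ((n:ℝ)⁻¹) := by
    have h1 := Real.rpow_le_rpow (by positivity) hreal (inv_nonneg.2 hn'.le)
    rwa [Real.mul_rpow (by positivity) hB0, Real.mul_rpow (by positivity) hI0,
      Real.pow_rpow_inv_natCast hm0 hn.ne', Real.pow_rpow_inv_natCast (by positivity) hn.ne'] at h1
  refine div_le_of_le_mul₀ (by positivity) hlam ?_
  calc n * B ^ ((n:ℝ)⁻¹) * m = n * (m * B ^ ((n:ℝ)⁻¹)) := by ring
    _ ≤ n * (lam / n * I ^ ((n:ℝ)⁻¹)) := mul_le_mul_of_nonneg_left hroot hn'.le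
    _ = lam * I ^ ((n:ℝ)⁻¹) := by field_simp
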